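/- Let T be a normal bounded operator on a Hilbert space. If a subsequence of powers T^{n_k} converges in the weak operator topology to an operator S, then S is normal. -/

import Mathlib

open Filter

local notation "⟪" x ", " y "⟫" => @inner ℂ _ _ x y

/-- If `T` is a normal bounded operator on a Hilbert space and `T^{n_k} → S` in the
weak operator topology, then `S` is normal. -/
theorem stmt_4 {H : Type*} [NormedAddCommGroup H] [InnerProductSpace ℂ H]
    [CompleteSpace H]
    (T S : H →L[ℂ] H)
    (hnormal : T ∘L ContinuousLinearMap.adjoint T = ContinuousLinearMap.adjoint T ∘L T)
    (n : ℕ → ℕ) (hn : StrictMono n)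
    (hS : ∀ x y : H, Tendsto (fun k => ⟪(T ^ n k) x, y⟫) atTop (nhds ⟪S x, y⟫)) :
    S ∘L ContinuousLinearMap.adjoint S = ContinuousLinearMap.adjoint S ∘L S := by
  have key : ∀ A : H →L[ℂ] H, Commute A T → Commute A S := by
    intro A hA
    refine ContinuousLinearMap.ext fun x => ext_inner_right ℂ fun y => ?_
    have h1 := hS x (ContinuousLinearMap.adjoint A y)
    have h2 := hS (A x) y
    have h3 : (fun k => ⟪(T ^ n k) x, ContinuousLinearMap.adjoint A y⟫)
        = fun k => ⟪(T ^ n k) (A x), y⟫ := by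
      funext k
      rw [ContinuousLinearMap.adjoint_inner_right]
      have h4 : A ((T ^ n k) x) = (T ^ n k) (A x) :=
        DFunLike.congr_fun (hA.pow_right (n k)).eq x
      rw [h4]
    rw [h3, ContinuousLinearMap.adjoint_inner_right] at h1
    exact tendsto_nhds_unique h1 h2
  have h1 : Commute (star T) S := key _ (show star T * T = T * star T from hnormal.symm)
  have h2 : Commute (star S) T := by
    have := h1.star_star
    rw [star_star] at this
    exact this.symm
  exact (key _ h2).symm.eq
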